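/- Let V₁ and V₂ be Gödel sets and h : V₁ → V₂ a strictly monotone map, continuous on V₁, with h(0) = 0 and h(1) = 1. For any valuation v₁ into V₁, let v₂ be the valuation into V₂ with the same universe defined on atomic formulas by P^{v₂}(m⃗) = h(P^{v₁}(m⃗)). Then v₂(φ) = h(v₁(φ)) for every closed formula φ, and consequently h(‖φ‖_{V₁}) ≥ ‖φ‖_{V₂} for all closed formulas φ. -/

import Mathlib

open Set

/-- Formulas of a relational first-order language with countably many predicate
symbols (symbol `p` has arity `ar p`); variables are de Bruijn indices. -/
inductive GFormula (ar : ℕ → ℕ) : Type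
  | bot : GFormula ar
  | atom (p : ℕ) (ts : Fin (ar p) → ℕ) : GFormula ar
  | conj : GFormula ar → GFormula ar → GFormula ar
  | disj : GFormula ar → GFormula ar → GFormula ar
  | imp : GFormula ar → GFormula ar → GFormula ar
  | all : GFormula ar → GFormula ar
  | ex : GFormula ar → GFormula ar

/-- All free variables of the formula are `< k`. -/
def GFormula.VarsBelow {ar : ℕ → ℕ} : ℕ → GFormula ar → Prop
  | _, .bot => True
  | k, .atom _ ts => ∀ i, ts i < k
  | k, .conj φ ψ => φ.VarsBelow k ∧ ψ.VarsBelow k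
  | k, .disj φ ψ => φ.VarsBelow k ∧ ψ.VarsBelow k
  | k, .imp φ ψ => φ.VarsBelow k ∧ ψ.VarsBelow k
  | k, .all φ => φ.VarsBelow (k+1)
  | k, .ex φ => φ.VarsBelow (k+1)

/-- A closed formula (sentence). -/
def GFormula.IsClosedF {ar : ℕ → ℕ} (φ : GFormula ar) : Prop := φ.VarsBelow 0

/-- The syntactic subformulas of a formula. -/
def GFormula.Subfs {ar : ℕ → ℕ} : GFormula ar → Set (GFormula ar)
  | .bot => {.bot}
  | .atom p ts => {.atom p ts}
  | .conj φ ψ => insert (.conj φ ψ) (φ.Subfs ∪ ψ.Subfs)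
  | .disj φ ψ => insert (.disj φ ψ) (φ.Subfs ∪ ψ.Subfs)
  | .imp φ ψ => insert (.imp φ ψ) (φ.Subfs ∪ ψ.Subfs)
  | .all φ => insert (.all φ) φ.Subfs
  | .ex φ => insert (.ex φ) φ.Subfs

/-- A Gödel set: a closed subset of `[0,1]` containing `0` and `1`. -/
def GodelSet (V : Set ℝ) : Prop :=
  IsClosed V ∧ V ⊆ Set.Icc (0:ℝ) 1 ∧ (0:ℝ) ∈ V ∧ (1:ℝ) ∈ V

/-- A valuation into `V`: a nonempty universe `M` together with interpretations of
all predicate symbols, taking values in `V`. -/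
structure GValuation (ar : ℕ → ℕ) (V : Set ℝ) where
  M : Type
  ne : Nonempty M
  interp : ∀ p : ℕ, (Fin (ar p) → M) → ℝ
  interp_mem : ∀ p t, interp p t ∈ V

/-- Prepend a value to an environment. -/
def consEnv {M : Type} (m : M) (e : ℕ → M) : ℕ → M
  | 0 => m
  | n+1 => e n

/-- The Gödel value of a formula under a valuation and an environment. -/
noncomputable def geval {ar : ℕ → ℕ} {V : Set ℝ} (v : GValuation ar V) :
    (ℕ → v.M) → GFormula ar → ℝ
  | _, .bot => 0
  | e, .atom p ts => v.interp p (fun i => e (ts i))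
  | e, .conj φ ψ => min (geval v e φ) (geval v e ψ)
  | e, .disj φ ψ => max (geval v e φ) (geval v e ψ)
  | e, .imp φ ψ => if geval v e φ ≤ geval v e ψ then 1 else geval v e ψ
  | e, .all φ => sInf (Set.range fun m : v.M => geval v (consEnv m e) φ)
  | e, .ex φ => sSup (Set.range fun m : v.M => geval v (consEnv m e) φ)

/-- The value `v(φ)` of a closed formula. -/
noncomputable def GValuation.val {ar : ℕ → ℕ} {V : Set ℝ}
    (v : GValuation ar V) (φ : GFormula ar) : ℝ :=
  geval v (fun _ => Classical.choice v.ne) φ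

/-- `‖φ‖_V`: the infimum of `v(φ)` over all valuations `v` into `V`. -/
noncomputable def GNorm (ar : ℕ → ℕ) (V : Set ℝ) (φ : GFormula ar) : ℝ :=
  sInf (Set.range fun v : GValuation ar V => v.val φ)

/-- The Gödel logic of `V`: all closed formulas with `‖φ‖_V = 1`. -/
def GLogic (ar : ℕ → ℕ) (V : Set ℝ) : Set (GFormula ar) :=
  {φ | φ.IsClosedF ∧ GNorm ar V φ = 1}

/-- A nonempty subset of a Gödel set has its infimum in the Gödel set. -/
theorem GodelSet.sInf_mem {V S : Set ℝ} (hV : GodelSet V) (hS : S ⊆ V) (hne : S.Nonempty) :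
    sInf S ∈ V :=
  closure_minimal hS hV.1 (csInf_mem_closure hne (bddBelow_Icc.mono (hS.trans hV.2.1)))

/-- A nonempty subset of a Gödel set has its supremum in the Gödel set. -/
theorem GodelSet.sSup_mem {V S : Set ℝ} (hV : GodelSet V) (hS : S ⊆ V) (hne : S.Nonempty) :
    sSup S ∈ V :=
  closure_minimal hS hV.1 (csSup_mem_closure hne (bddAbove_Icc.mono (hS.trans hV.2.1)))

/-- A monotone continuous map on a Gödel set commutes with infima. -/
theorem GodelSet.map_sInf {V S : Set ℝ} (hV : GodelSet V) (hS : S ⊆ V) (hne : S.Nonempty)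
    {h : ℝ → ℝ} (hmono : MonotoneOn h V) (hcont : ContinuousOn h V) :
    h (sInf S) = sInf (h '' S) :=
  MonotoneOn.map_csInf_of_continuousWithinAt ((hcont _ (hV.sInf_mem hS hne)).mono hS)
    (hmono.mono hS) hne (bddBelow_Icc.mono (hS.trans hV.2.1))

/-- A monotone continuous map on a Gödel set commutes with suprema. -/
theorem GodelSet.map_sSup {V S : Set ℝ} (hV : GodelSet V) (hS : S ⊆ V) (hne : S.Nonempty)
    {h : ℝ → ℝ} (hmono : MonotoneOn h V) (hcont : ContinuousOn h V) :
    h (sSup S) = sSup (h '' S) :=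
  MonotoneOn.map_csSup_of_continuousWithinAt ((hcont _ (hV.sSup_mem hS hne)).mono hS)
    (hmono.mono hS) hne (bddAbove_Icc.mono (hS.trans hV.2.1))

/-- The values of a valuation into a Gödel set lie in that set. -/
theorem geval_mem {ar : ℕ → ℕ} {V : Set ℝ} (hV : GodelSet V) (v : GValuation ar V)
    (φ : GFormula ar) (e : ℕ → v.M) : geval v e φ ∈ V := by
  have := v.ne
  induction φ generalizing e with
  | bot => exact hV.2.2.1
  | atom p ts => exact v.interp_mem _ _
  | conj φ ψ ihφ ihψ =>
    rw [geval]
    rcases min_choice (geval v e φ) (geval v e ψ) with h | h <;> rw [h]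
    exacts [ihφ e, ihψ e]
  | disj φ ψ ihφ ihψ =>
    rw [geval]
    rcases max_choice (geval v e φ) (geval v e ψ) with h | h <;> rw [h]
    exacts [ihφ e, ihψ e]
  | imp φ ψ _ ihψ =>
    rw [geval]
    split_ifs
    exacts [hV.2.2.2, ihψ e]
  | all φ ih => exact hV.sInf_mem (range_subset_iff.2 fun m => ih _) (range_nonempty _)
  | ex φ ih => exact hV.sSup_mem (range_subset_iff.2 fun m => ih _) (range_nonempty _)

/-- The valuation obtained by composing the atomic values with a map `h`. -/
def GValuation.map {ar : ℕ → ℕ} {V₁ V₂ : Set ℝ} (v : GValuation ar V₁) (h : ℝ → ℝ)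
    (hmap : ∀ x ∈ V₁, h x ∈ V₂) : GValuation ar V₂ :=
  ⟨v.M, v.ne, fun p t => h (v.interp p t), fun p t => hmap _ (v.interp_mem p t)⟩

/-- A strictly monotone continuous map preserving `0` and `1` commutes with evaluation. -/
theorem geval_map {ar : ℕ → ℕ} {V₁ V₂ : Set ℝ} (hV₁ : GodelSet V₁) {h : ℝ → ℝ}
    (hmap : ∀ x ∈ V₁, h x ∈ V₂) (hmono : StrictMonoOn h V₁) (hcont : ContinuousOn h V₁)
    (h0 : h 0 = 0) (h1 : h 1 = 1) (v : GValuation ar V₁) (φ : GFormula ar) (e : ℕ → v.M) :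
    geval (v.map h hmap) e φ = h (geval v e φ) := by
  have := v.ne
  have hmem := geval_mem hV₁ v
  induction φ generalizing e with
  | bot => exact h0.symm
  | atom p ts => rfl
  | conj φ ψ ihφ ihψ =>
    simp only [geval]
    rw [ihφ, ihψ, hmono.monotoneOn.map_min (hmem φ e) (hmem ψ e)]
  | disj φ ψ ihφ ihψ =>
    simp only [geval]
    rw [ihφ, ihψ, hmono.monotoneOn.map_max (hmem φ e) (hmem ψ e)]
  | imp φ ψ ihφ ihψ =>
    simp only [geval]
    rw [ihφ, ihψ, apply_ite h, h1]
    simp only [hmono.le_iff_le (hmem φ e) (hmem ψ e)]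
  | all φ ih =>
    simp only [geval]
    rw [hV₁.map_sInf (range_subset_iff.2 fun m => hmem φ _) (range_nonempty _)
      hmono.monotoneOn hcont, ← range_comp]
    exact congrArg (fun f => sInf (range f)) (funext fun m => ih (consEnv m e))
  | ex φ ih =>
    simp only [geval]
    rw [hV₁.map_sSup (range_subset_iff.2 fun m => hmem φ _) (range_nonempty _)
      hmono.monotoneOn hcont, ← range_comp]
    exact congrArg (fun f => sSup (range f)) (funext fun m => ih (consEnv m e))

/-- For a strictly monotone `h : V₁ → V₂`, continuous on `V₁`, preserving `0` and `1`:
the valuation `v₂` induced from `v₁` by composing atomic values with `h` satisfies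
`v₂(φ) = h(v₁(φ))` for closed `φ`, and consequently `‖φ‖_{V₂} ≤ h(‖φ‖_{V₁})`. -/
theorem stmt15 (ar : ℕ → ℕ) (V₁ V₂ : Set ℝ)
    (hV₁ : GodelSet V₁) (hV₂ : GodelSet V₂)
    (h : ℝ → ℝ) (hmap : ∀ x ∈ V₁, h x ∈ V₂)
    (hmono : ∀ x ∈ V₁, ∀ y ∈ V₁, x < y → h x < h y)
    (hcont : ContinuousOn h V₁) (h0 : h 0 = 0) (h1 : h 1 = 1)
    (v₁ : GValuation ar V₁) :
    (∀ φ : GFormula ar, φ.IsClosedF →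
      (GValuation.mk v₁.M v₁.ne (fun p t => h (v₁.interp p t))
          (fun p t => hmap _ (v₁.interp_mem p t)) : GValuation ar V₂).val φ
        = h (v₁.val φ)) ∧
    (∀ φ : GFormula ar, φ.IsClosedF → GNorm ar V₂ φ ≤ h (GNorm ar V₁ φ)) := by
  have hmono' : StrictMonoOn h V₁ := fun x hx y hy => hmono x hx y hy
  have hval (v : GValuation ar V₁) (φ : GFormula ar) : (v.map h hmap).val φ = h (v.val φ) :=
    geval_map hV₁ hmap hmono' hcont h0 h1 v φ _
  refine ⟨fun φ _ => hval v₁ φ, fun φ _ => ?_⟩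
  have hne : (range fun v : GValuation ar V₁ => v.val φ).Nonempty := ⟨_, v₁, rfl⟩
  have hsub : (range fun v : GValuation ar V₁ => v.val φ) ⊆ V₁ :=
    range_subset_iff.2 fun v => geval_mem hV₁ v φ _
  have hbdd : BddBelow (range fun v : GValuation ar V₂ => v.val φ) :=
    bddBelow_Icc.mono ((range_subset_iff.2 fun v => geval_mem hV₂ v φ _).trans hV₂.2.1)
  rw [GNorm, GNorm, hV₁.map_sInf hsub hne hmono'.monotoneOn hcont]
  refine csInf_le_csInf hbdd (hne.image h) ?_
  rintro _ ⟨_, ⟨v, rfl⟩, rfl⟩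
  exact ⟨v.map h hmap, hval v φ⟩
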